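/- Let M be a Fraïssé limit of K₀. Then for every n ≥ 3, the binary relation induced by Eₙ on the set of n-element subsets of M is an equivalence relation which has infinitely many equivalence classes, and each of its equivalence classes is infinite. -/

import Mathlib

open FirstOrder FirstOrder.Language

/-- The relation symbols of the language `L₀`: for each `n ≥ 3`,
a symbol `Eₙ` of arity `2 * n`. -/
inductive L0Rel : ℕ → Type
  | E (n : ℕ) (hn : 3 ≤ n) : L0Rel (2 * n)

/-- The language `L₀`, with one relation symbol `Eₙ` of arity `2n` for each `n ≥ 3`,
and no function symbols. -/
def L0 : FirstOrder.Language :=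
  { Functions := fun _ => Empty
    Relations := L0Rel }

/-- The interpretation of `Eₙ` as a binary relation on `n`-tuples:
`ERel n hn x y` holds iff `Eₙ(x̄, ȳ)` holds of the concatenated `2n`-tuple. -/
def ERel {M : Type*} [L0.Structure M] (n : ℕ) (hn : 3 ≤ n) (x y : Fin n → M) : Prop :=
  Structure.RelMap (L := L0) (L0Rel.E n hn) (Fin.append x y ∘ Fin.cast (two_mul n))

/-- Membership in the class `K₀`: a finite `L₀`-structure in which,
for each `n ≥ 3`, `Eₙ` holds only on `2n`-tuples whose halves each consist of `n`
pairwise distinct elements, is invariant under separately permuting the entries of the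
two halves, induces an equivalence relation on the `n`-element subsets
(reflexivity on injective tuples, symmetry and transitivity), and is empty when
`n` exceeds the cardinality of the structure. -/
def MemK0 (A : Type*) [L0.Structure A] : Prop :=
  Finite A ∧ ∀ (n : ℕ) (hn : 3 ≤ n),
    (∀ x y : Fin n → A, ERel n hn x y → Function.Injective x ∧ Function.Injective y) ∧
    (∀ (x y : Fin n → A) (σ τ : Equiv.Perm (Fin n)),
      ERel n hn x y → ERel n hn (x ∘ σ) (y ∘ τ)) ∧
    (∀ x : Fin n → A, Function.Injective x → ERel n hn x x) ∧
    (∀ x y : Fin n → A, ERel n hn x y → ERel n hn y x) ∧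
    (∀ x y z : Fin n → A, ERel n hn x y → ERel n hn y z → ERel n hn x z) ∧
    (n > Nat.card A → ∀ x y : Fin n → A, ¬ ERel n hn x y)

/-- `M` is a Fraïssé limit of `K₀`: a countable ultrahomogeneous `L₀`-structure whose
age (the class of structures isomorphic to finite substructures of `M`) is exactly `K₀`
up to isomorphism. -/
def IsFraisseLimitK0 (M : Type) [L0.Structure M] : Prop :=
  Countable M ∧ L0.IsUltrahomogeneous M ∧
    ∀ N : CategoryTheory.Bundled.{0} L0.Structure, N ∈ L0.age M ↔ MemK0 N

/-- The binary relation induced by `Eₙ` on (`n`-element) subsets of `M`, given as finsets: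
two finsets are related iff some (equivalently, by permutation invariance, any)
enumerations of them are `Eₙ`-related. -/
def EFinset {M : Type*} [L0.Structure M] (n : ℕ) (hn : 3 ≤ n) (s t : Finset M) : Prop :=
  ∃ x y : Fin n → M, Set.range x = ↑s ∧ Set.range y = ↑t ∧ ERel n hn x y

/-- The `L₀`-structure on `A` in which `Eₙ` is interpreted as `R n`. -/
@[reducible]
def structureOfRel {A : Type*} (R : ∀ n, 3 ≤ n → (Fin n → A) → (Fin n → A) → Prop) :
    L0.Structure A where
  funMap := fun f => Empty.elim f
  RelMap := fun r v =>
    match r, v with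
    | .E n hn, v => R n hn (fun i => v (Fin.cast (two_mul n).symm (Fin.castAdd n i)))
        (fun i => v (Fin.cast (two_mul n).symm (Fin.natAdd n i)))

theorem eRel_structureOfRel {A : Type*}
    (R : ∀ n, 3 ≤ n → (Fin n → A) → (Fin n → A) → Prop) (n : ℕ) (hn : 3 ≤ n)
    (x y : Fin n → A) : @ERel A (structureOfRel R) n hn x y ↔ R n hn x y := by
  simp [ERel, Structure.RelMap, -Fin.natAdd_eq_addNat]

theorem append_halves {A : Type*} {n : ℕ} (v : Fin (2 * n) → A) :
    Fin.append (fun i => v (Fin.cast (two_mul n).symm (Fin.castAdd n i)))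
      (fun i => v (Fin.cast (two_mul n).symm (Fin.natAdd n i))) ∘ Fin.cast (two_mul n) = v := by
  funext i
  obtain ⟨j, rfl⟩ := (finCongr (two_mul n).symm).surjective i
  refine Fin.addCases (fun k => ?_) (fun k => ?_) j <;> simp [-Fin.natAdd_eq_addNat]

/-- An injection that preserves and reflects every `Eₙ` is an embedding of `L₀`-structures. -/
def embeddingOfERel {A B : Type*} [L0.Structure A] [L0.Structure B] (f : A → B)
    (hf : Function.Injective f)
    (h : ∀ n hn (x y : Fin n → A), ERel n hn (f ∘ x) (f ∘ y) ↔ ERel n hn x y) :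
    A ↪[L0] B where
  toFun := f
  inj' := hf
  map_fun' := fun g => Empty.elim g
  map_rel' := fun r v => by
    obtain ⟨n, hn⟩ := r
    have key := h n hn (fun i => v (Fin.cast (two_mul n).symm (Fin.castAdd n i)))
      (fun i => v (Fin.cast (two_mul n).symm (Fin.natAdd n i)))
    unfold ERel at key
    rw [append_halves v] at key
    have halves := append_halves (f ∘ v)
    simp only [Function.comp_def] at halves key ⊢
    rwa [halves] at key

theorem Embedding.eRel_iff {A B : Type*} [L0.Structure A] [L0.Structure B] (f : A ↪[L0] B)
    (n : ℕ) (hn : 3 ≤ n) (x y : Fin n → A) :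
    ERel n hn (f ∘ x) (f ∘ y) ↔ ERel n hn x y := by
  have h := f.map_rel (L0Rel.E n hn : L0.Relations (2 * n))
    (Fin.append x y ∘ Fin.cast (two_mul n))
  have comp_append : f ∘ Fin.append x y = Fin.append (f ∘ x) (f ∘ y) := by
    funext i
    refine Fin.addCases (fun k => ?_) (fun k => ?_) i <;> simp [-Fin.natAdd_eq_addNat]
  rw [← Function.comp_assoc, comp_append] at h
  exact h

/-- Every `Eₙ` holds only on pairs of injective tuples, is invariant under permuting
either half, and induces an equivalence relation on `n`-element subsets. -/
structure IsESystem (A : Type*) [L0.Structure A] : Prop where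
  injective : ∀ n hn (x y : Fin n → A), ERel n hn x y →
    Function.Injective x ∧ Function.Injective y
  perm : ∀ n hn (x y : Fin n → A) (σ τ : Equiv.Perm (Fin n)), ERel n hn x y →
    ERel n hn (x ∘ σ) (y ∘ τ)
  refl : ∀ n hn (x : Fin n → A), Function.Injective x → ERel n hn x x
  symm : ∀ n hn (x y : Fin n → A), ERel n hn x y → ERel n hn y x
  trans : ∀ n hn (x y z : Fin n → A), ERel n hn x y → ERel n hn y z → ERel n hn x z

theorem MemK0.isESystem {A : Type*} [L0.Structure A] (h : MemK0 A) : IsESystem A where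
  injective n hn := (h.2 n hn).1
  perm n hn := (h.2 n hn).2.1
  refl n hn := (h.2 n hn).2.2.1
  symm n hn := (h.2 n hn).2.2.2.1
  trans n hn := (h.2 n hn).2.2.2.2.1

theorem IsESystem.memK0 {A : Type*} [L0.Structure A] [Finite A] (h : IsESystem A) :
    MemK0 A := by
  refine ⟨inferInstance, fun n hn => ⟨h.injective n hn, h.perm n hn, h.refl n hn, h.symm n hn,
    h.trans n hn, fun hc x y hxy => ?_⟩⟩
  have := Nat.card_le_card_of_injective x (h.injective n hn x y hxy).1
  rw [Nat.card_fin] at this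
  omega

/-- The `L₀`-structure induced on a subset. -/
@[reducible]
def inducedStructure {M : Type*} [L0.Structure M] (s : Set M) : L0.Structure s :=
  structureOfRel fun n hn x y => ERel n hn (Subtype.val ∘ x) (Subtype.val ∘ y)

theorem eRel_inducedStructure {M : Type*} [L0.Structure M] (s : Set M) (n : ℕ) (hn : 3 ≤ n)
    (x y : Fin n → s) : @ERel s (inducedStructure s) n hn x y ↔
      ERel n hn (Subtype.val ∘ x) (Subtype.val ∘ y) :=
  eRel_structureOfRel (fun n hn x y => ERel n hn (Subtype.val ∘ x) (Subtype.val ∘ y)) n hn x y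

/-- The inclusion of a subset with the induced structure. -/
def inducedEmbedding {M : Type*} [L0.Structure M] (s : Set M) :
    @Language.Embedding L0 s M (inducedStructure s) _ :=
  letI := inducedStructure s
  embeddingOfERel Subtype.val Subtype.val_injective
    fun n hn x y => (eRel_inducedStructure s n hn x y).symm

namespace IsFraisseLimitK0

variable {M : Type} [L0.Structure M]

theorem nonempty_embedding (hM : IsFraisseLimitK0 M) (A : Type) [L0.Structure A]
    (hA : MemK0 A) : Nonempty (A ↪[L0] M) :=
  ((hM.2.2 ⟨A, inferInstance⟩).2 hA).2

theorem memK0_of_embedding (hM : IsFraisseLimitK0 M) {A : Type} [L0.Structure A] [Finite A]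
    (f : A ↪[L0] M) : MemK0 A :=
  (hM.2.2 ⟨A, inferInstance⟩).1 ⟨Structure.FG.of_finite, ⟨f⟩⟩

theorem isESystem_induced (hM : IsFraisseLimitK0 M) (s : Set M) [Finite s] :
    @IsESystem s (inducedStructure s) :=
  letI := inducedStructure s
  (hM.memK0_of_embedding (inducedEmbedding s)).isESystem

theorem isESystem (hM : IsFraisseLimitK0 M) : IsESystem M := by
  have lift : ∀ {n : ℕ} (x y z : Fin n → M), ∃ (s : Set M) (_ : Finite s)
      (x' y' z' : Fin n → s), x = Subtype.val ∘ x' ∧ y = Subtype.val ∘ y' ∧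
        z = Subtype.val ∘ z' := fun x y z =>
    ⟨Set.range x ∪ Set.range y ∪ Set.range z, inferInstance,
      fun i => ⟨x i, by simp⟩, fun i => ⟨y i, by simp⟩, fun i => ⟨z i, by simp⟩,
      rfl, rfl, rfl⟩
  have transfer : ∀ (s : Set M) n hn (x y : Fin n → s),
      ERel n hn (Subtype.val ∘ x) (Subtype.val ∘ y) ↔ @ERel s (inducedStructure s) n hn x y :=
    fun s n hn x y => (eRel_inducedStructure s n hn x y).symm
  constructor
  · intro n hn x y h
    obtain ⟨s, _, x, y, -, rfl, rfl, -⟩ := lift x y y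
    let := inducedStructure s
    obtain ⟨hx, hy⟩ := (hM.isESystem_induced s).injective n hn x y ((transfer s n hn x y).1 h)
    exact ⟨Subtype.val_injective.comp hx, Subtype.val_injective.comp hy⟩
  · intro n hn x y σ τ h
    obtain ⟨s, _, x, y, -, rfl, rfl, -⟩ := lift x y y
    let := inducedStructure s
    exact (transfer s n hn (x ∘ σ) (y ∘ τ)).2
      ((hM.isESystem_induced s).perm n hn x y σ τ ((transfer s n hn x y).1 h))
  · intro n hn x h
    obtain ⟨s, _, x, -, -, rfl, -, -⟩ := lift x x x
    let := inducedStructure s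
    exact (transfer s n hn x x).2 ((hM.isESystem_induced s).refl n hn x h.of_comp)
  · intro n hn x y h
    obtain ⟨s, _, x, y, -, rfl, rfl, -⟩ := lift x y y
    let := inducedStructure s
    exact (transfer s n hn y x).2
      ((hM.isESystem_induced s).symm n hn x y ((transfer s n hn x y).1 h))
  · intro n hn x y z h k
    obtain ⟨s, _, x, y, z, rfl, rfl, rfl⟩ := lift x y z
    let := inducedStructure s
    exact (transfer s n hn x z).2 ((hM.isESystem_induced s).trans n hn x y z
      ((transfer s n hn x y).1 h) ((transfer s n hn y z).1 k))

end IsFraisseLimitK0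

theorem exists_perm_of_range_eq {A : Type*} {n : ℕ} {x y : Fin n → A}
    (hx : Function.Injective x) (hy : Function.Injective y) (h : Set.range x = Set.range y) :
    ∃ σ : Equiv.Perm (Fin n), y = x ∘ σ := by
  refine ⟨(Equiv.ofInjective y hy).trans
    ((Equiv.setCongr h.symm).trans (Equiv.ofInjective x hx).symm), ?_⟩
  funext i
  exact (congrArg Subtype.val ((Equiv.ofInjective x hx).apply_symm_apply
    (Equiv.setCongr h.symm (Equiv.ofInjective y hy i)))).symm

theorem IsESystem.eRel_of_range_eq {A : Type*} [L0.Structure A] (hA : IsESystem A) {n : ℕ}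
    (hn : 3 ≤ n) {x x' y y' : Fin n → A} (h : ERel n hn x y)
    (hx' : Function.Injective x') (hy' : Function.Injective y')
    (hx : Set.range x = Set.range x') (hy : Set.range y = Set.range y') : ERel n hn x' y' := by
  obtain ⟨ix, iy⟩ := hA.injective n hn x y h
  obtain ⟨σ, rfl⟩ := exists_perm_of_range_eq ix hx' hx
  obtain ⟨τ, rfl⟩ := exists_perm_of_range_eq iy hy' hy
  exact hA.perm n hn x y σ τ h

theorem IsESystem.eFinset_trans {A : Type*} [L0.Structure A] (hA : IsESystem A) {n : ℕ}
    (hn : 3 ≤ n) {s t u : Finset A} (h : EFinset n hn s t) (k : EFinset n hn t u) :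
    EFinset n hn s u := by
  obtain ⟨x, y, hx, hy, hxy⟩ := h
  obtain ⟨y', z, hy', hz, hyz⟩ := k
  refine ⟨x, z, hx, hz, hA.trans n hn x y z hxy ?_⟩
  exact hA.eRel_of_range_eq hn hyz (hA.injective n hn x y hxy).2
    (hA.injective n hn y' z hyz).2 (hy'.trans hy.symm) rfl

theorem EFinset.symm {A : Type*} [L0.Structure A] (hA : IsESystem A) {n : ℕ}
    {hn : 3 ≤ n} {s t : Finset A} : EFinset n hn s t → EFinset n hn t s := by
  rintro ⟨x, y, hx, hy, hxy⟩
  exact ⟨y, x, hy, hx, hA.symm n hn x y hxy⟩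

theorem exists_injective_range_eq {A : Type*} {n : ℕ} {s : Finset A} (hs : s.card = n) :
    ∃ x : Fin n → A, Function.Injective x ∧ Set.range x = ↑s := by
  refine ⟨fun i => ((s.equivFinOfCardEq hs).symm i : A),
    Subtype.val_injective.comp (Equiv.injective _), ?_⟩
  exact ((s.equivFinOfCardEq hs).symm.surjective.range_comp Subtype.val).trans
    Subtype.range_coe

theorem IsESystem.eFinset_refl {A : Type*} [L0.Structure A] (hA : IsESystem A) {n : ℕ}
    (hn : 3 ≤ n) {s : Finset A} (hs : s.card = n) : EFinset n hn s s := by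
  obtain ⟨x, hx, hr⟩ := exists_injective_range_eq hs
  exact ⟨x, x, hr, hr, hA.refl n hn x hx⟩

/-- The `L₀`-structure on `A` in which distinct finite subsets are never related. -/
@[reducible]
def discreteStructure (A : Type*) : L0.Structure A :=
  structureOfRel fun _ _ x y =>
    Function.Injective x ∧ Function.Injective y ∧ Set.range x = Set.range y

theorem isESystem_discreteStructure (A : Type*) : @IsESystem A (discreteStructure A) := by
  let := discreteStructure A
  constructor <;> intro n hn <;> simp only [eRel_structureOfRel]
  · exact fun x y h => ⟨h.1, h.2.1⟩
  · rintro x y σ τ ⟨hx, hy, h⟩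
    exact ⟨hx.comp σ.injective, hy.comp τ.injective, by
      rw [σ.surjective.range_comp, τ.surjective.range_comp, h]⟩
  · exact fun x hx => by simpa using hx
  · exact fun x y h => ⟨h.2.1, h.1, h.2.2.symm⟩
  · exact fun x y z h k => ⟨h.1, k.2.1, h.2.2.trans k.2.2⟩

/-- The `L₀`-structure on `A × B` in which transversal tuples are related according to their
projections to `A`, and all other injective tuples of the same length are related. -/
@[reducible]
def blowUpStructure (A B : Type*) [L0.Structure A] : L0.Structure (A × B) :=
  structureOfRel fun n hn x y => Function.Injective x ∧ Function.Injective y ∧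
    (ERel n hn (Prod.fst ∘ x) (Prod.fst ∘ y) ∨
      ¬ Function.Injective (Prod.fst ∘ x) ∧ ¬ Function.Injective (Prod.fst ∘ y))

theorem IsESystem.blowUp {A : Type*} [L0.Structure A] (hA : IsESystem A) (B : Type*) :
    @IsESystem (A × B) (blowUpStructure A B) := by
  let := blowUpStructure A B
  constructor <;> intro n hn <;> simp only [eRel_structureOfRel]
  · exact fun x y h => ⟨h.1, h.2.1⟩
  · rintro x y σ τ ⟨hx, hy, h⟩
    refine ⟨hx.comp σ.injective, hy.comp τ.injective, h.imp (hA.perm n hn _ _ σ τ) ?_⟩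
    rw [← Function.comp_assoc, ← Function.comp_assoc, Equiv.injective_comp,
      Equiv.injective_comp]
    exact id
  · exact fun x hx => ⟨hx, hx, (em _).imp_left (hA.refl n hn _) |>.imp_right fun h => ⟨h, h⟩⟩
  · exact fun x y h => ⟨h.2.1, h.1, h.2.2.imp (hA.symm n hn _ _) And.symm⟩
  · rintro x y z ⟨hx, -, h⟩ ⟨-, hz, k⟩
    refine ⟨hx, hz, ?_⟩
    rcases h with h | h <;> rcases k with k | k
    · exact .inl (hA.trans n hn _ _ _ h k)
    · exact absurd (hA.injective n hn _ _ h).2 k.1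
    · exact absurd (hA.injective n hn _ _ k).1 h.2
    · exact .inr ⟨h.1, k.2⟩

/-- The embedding of `A` as a layer of `A × B`. -/
def blowUpEmbedding {A B : Type*} [L0.Structure A] (hA : IsESystem A) (b : B) :
    @Language.Embedding L0 A (A × B) _ (blowUpStructure A B) :=
  letI := blowUpStructure A B
  embeddingOfERel (fun a => (a, b)) (Prod.mk_left_injective b) fun n hn x y => by
    rw [eRel_structureOfRel]
    constructor
    · rintro ⟨hx, hy, h | h⟩
      · exact h
      · exact absurd hx.of_comp h.1
    · intro h
      obtain ⟨hx, hy⟩ := hA.injective n hn x y h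
      exact ⟨(Prod.mk_left_injective b).comp hx, (Prod.mk_left_injective b).comp hy, .inl h⟩

namespace IsFraisseLimitK0

variable {M : Type} [L0.Structure M]

theorem exists_pairwise_not_eFinset (hM : IsFraisseLimitK0 M) {n : ℕ} (hn : 3 ≤ n) (N : ℕ) :
    ∃ f : Fin N → Finset M, (∀ i, (f i).card = n) ∧
      ∀ i j, i ≠ j → ¬ EFinset n hn (f i) (f j) := by
  classical
  let := discreteStructure (Fin N × Fin n)
  obtain ⟨e⟩ := hM.nonempty_embedding _ (isESystem_discreteStructure (Fin N × Fin n)).memK0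
  have inj : ∀ i : Fin N, Function.Injective fun k : Fin n => (i, k) :=
    fun i => Prod.mk_right_injective i
  refine ⟨fun i => Finset.univ.image (e ∘ fun k : Fin n => (i, k)), fun i => ?_, ?_⟩
  · rw [Finset.card_image_of_injective _ (e.injective.comp (inj i)), Finset.card_fin]
  · rintro i j hij ⟨x, y, hx, hy, hxy⟩
    rw [Finset.coe_image, Finset.coe_univ, Set.image_univ] at hx hy
    have h := hM.isESystem.eRel_of_range_eq hn hxy (e.injective.comp (inj i))
      (e.injective.comp (inj j)) hx hy
    rw [Embedding.eRel_iff, eRel_structureOfRel] at h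
    have hmem : (i, (⟨0, by omega⟩ : Fin n)) ∈ Set.range fun k : Fin n => (j, k) :=
      h.2.2 ▸ Set.mem_range_self _
    obtain ⟨k, hk⟩ := hmem
    exact hij (congrArg Prod.fst hk).symm

theorem exists_sequence_not_eFinset (hM : IsFraisseLimitK0 M) {n : ℕ} (hn : 3 ≤ n) :
    ∃ f : ℕ → Finset M, (∀ i, (f i).card = n) ∧
      ∀ i j, i ≠ j → ¬ EFinset n hn (f i) (f j) := by
  let S : Setoid {s : Finset M // s.card = n} :=
    { r := fun s t => EFinset n hn s.1 t.1
      iseqv := ⟨fun s => hM.isESystem.eFinset_refl hn s.2, EFinset.symm hM.isESystem,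
        fun h k => hM.isESystem.eFinset_trans hn h k⟩ }
  have : Infinite (Quotient S) := by
    refine ⟨fun _ => ?_⟩
    obtain ⟨f, hf, hne⟩ := hM.exists_pairwise_not_eFinset hn (Nat.card (Quotient S) + 1)
    have hinj : Function.Injective fun i => Quotient.mk S ⟨f i, hf i⟩ := fun i j h => by
      by_contra hij
      exact hne i j hij (Quotient.exact h)
    have := Nat.card_le_card_of_injective _ hinj
    rw [Nat.card_fin] at this
    omega
  let g := Infinite.natEmbedding (Quotient S)
  refine ⟨fun i => (g i).out, fun i => (g i).out.2, fun i j hij h => hij (g.injective ?_)⟩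
  exact Quotient.out_equiv_out.1 h

theorem infinite_eFinset (hM : IsFraisseLimitK0 M) {n : ℕ} (hn : 3 ≤ n) {s : Finset M}
    (hs : s.card = n) : {t : Finset M | EFinset n hn s t}.Infinite := by
  classical
  intro hfin
  have := hfin.to_subtype
  set N := Nat.card {t : Finset M | EFinset n hn s t}
  obtain ⟨x, hx, hr⟩ := exists_injective_range_eq hs
  let := inducedStructure (s : Set M)
  have hA := hM.isESystem_induced (s : Set M)
  let := blowUpStructure (s : Set M) (Fin (N + 1))
  have := hM.nonempty_embedding _ (hA.blowUp (Fin (N + 1))).memK0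
  obtain ⟨f, hf⟩ := hM.2.1.extend_embedding Structure.FG.of_finite
    (inducedEmbedding (s : Set M)) (blowUpEmbedding hA (0 : Fin (N + 1)))
  let x' : Fin n → (s : Set M) := fun i => ⟨x i, hr ▸ Set.mem_range_self i⟩
  have hx' : Function.Injective x' := fun i j h => hx (congrArg Subtype.val h)
  have layer_injective : ∀ b : Fin (N + 1), Function.Injective fun i => (x' i, b) :=
    fun b => (Prod.mk_left_injective b).comp hx'
  let t : Fin (N + 1) → Finset M := fun b => Finset.univ.image (f ∘ fun i => (x' i, b))
  have hx0 : x = f ∘ fun i => (x' i, 0) :=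
    funext fun i => DFunLike.congr_fun hf (x' i)
  have ht : ∀ b, EFinset n hn s (t b) := fun b => by
    refine ⟨x, f ∘ fun i => (x' i, b), hr, by simp [t, Function.comp_def], ?_⟩
    rw [hx0, Embedding.eRel_iff, eRel_structureOfRel]
    exact ⟨layer_injective 0, layer_injective b, .inl (hA.refl n hn x' hx')⟩
  have ht_inj : Function.Injective fun b => (⟨t b, ht b⟩ :
      ↥{t : Finset M | EFinset n hn s t}) := fun b c h => by
    have hbc : t b = t c := congrArg Subtype.val h
    have hmem : f (x' ⟨0, by omega⟩, b) ∈ t c :=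
      hbc ▸ Finset.mem_image_of_mem (f ∘ fun i => (x' i, b)) (Finset.mem_univ _)
    obtain ⟨i, -, hi⟩ := Finset.mem_image.1 hmem
    exact (congrArg Prod.snd (f.injective hi)).symm
  have := Nat.card_le_card_of_injective _ ht_inj
  rw [Nat.card_fin] at this
  exact absurd this (Nat.not_succ_le_self N)

end IsFraisseLimitK0

/-- In a Fraïssé limit `M` of `K₀`, for every `n ≥ 3` the relation
induced by `Eₙ` on `n`-element subsets of `M` is an equivalence relation with infinitely
many classes, each of which is infinite. -/
theorem fraisse_limit_E_equivalence (M : Type) [L0.Structure M]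
    (hM : IsFraisseLimitK0 M) (n : ℕ) (hn : 3 ≤ n) :
    (∀ s : Finset M, s.card = n → EFinset n hn s s) ∧
    (∀ s t : Finset M, EFinset n hn s t → EFinset n hn t s) ∧
    (∀ s t u : Finset M, EFinset n hn s t → EFinset n hn t u → EFinset n hn s u) ∧
    (∃ f : ℕ → Finset M, (∀ i, (f i).card = n) ∧
      ∀ i j, i ≠ j → ¬ EFinset n hn (f i) (f j)) ∧
    (∀ s : Finset M, s.card = n → {t : Finset M | EFinset n hn s t}.Infinite) := by
  exact ⟨fun _ hs => hM.isESystem.eFinset_refl hn hs, fun _ _ => EFinset.symm hM.isESystem,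
    fun _ _ _ => hM.isESystem.eFinset_trans hn, hM.exists_sequence_not_eFinset hn,
    fun _ hs => hM.infinite_eFinset hn hs⟩
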